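/- Let C be a triangulated category endowed with a bounded weight structure w. Then w extends to a bounded weight structure on the idempotent completion of C (with its canonical triangulated structure), and the heart of this extended weight structure is the idempotent completion of the heart Hw of w. -/

import Mathlib

open CategoryTheory CategoryTheory.Limits CategoryTheory.Pretriangulated

universe v u

namespace Paper

/-- `X` is a retract of `Y`: the identity of `X` factors through `Y`. -/
def IsRetractOf {C : Type u} [Category.{v} C] (X Y : C) : Prop :=
  ∃ (i : X ⟶ Y) (r : Y ⟶ X), i ≫ r = 𝟙 X

variable (C : Type u) [Category.{v} C] [HasZeroObject C] [Preadditive C] [HasShift C ℤ]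
  [∀ n : ℤ, (shiftFunctor C n).Additive] [Pretriangulated C]

/-- A class of objects is extension-stable if for every distinguished triangle
`A ⟶ B ⟶ C'`, if `A` and `C'` lie in the class then so does `B`. -/
def ExtStable (S : Set C) : Prop :=
  ∀ T : Triangle C, T ∈ (distTriang C) → T.obj₁ ∈ S → T.obj₃ ∈ S → T.obj₂ ∈ S

/-- A weight structure on a (pre)triangulated category `C`:
two additive, Karoubi-closed classes `le = C^{w≤0}` and `ge = C^{w≥0}` satisfying
semi-invariance with respect to translations, orthogonality, and the existence of
weight decompositions (stated in the rotated form `X ⟶ A ⟶ B ⟶ X[1]`,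
equivalent to the triangle `B[-1] ⟶ X ⟶ A ⟶ B`). -/
structure WeightStructure where
  le : Set C
  ge : Set C
  le_retract : ∀ ⦃X Y : C⦄, IsRetractOf X Y → Y ∈ le → X ∈ le
  ge_retract : ∀ ⦃X Y : C⦄, IsRetractOf X Y → Y ∈ ge → X ∈ ge
  le_add : ∀ ⦃X Y : C⦄, X ∈ le → Y ∈ le →
    ∀ b : BinaryBicone X Y, Nonempty b.IsBilimit → b.pt ∈ le
  ge_add : ∀ ⦃X Y : C⦄, X ∈ ge → Y ∈ ge →
    ∀ b : BinaryBicone X Y, Nonempty b.IsBilimit → b.pt ∈ ge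
  le_shift : ∀ ⦃X : C⦄, X ∈ le → X⟦(1 : ℤ)⟧ ∈ le
  ge_shift : ∀ ⦃X : C⦄, X ∈ ge → X⟦(-1 : ℤ)⟧ ∈ ge
  orth : ∀ ⦃X Y : C⦄, X ∈ ge → Y ∈ le → ∀ f : X ⟶ Y⟦(1 : ℤ)⟧, f = 0
  decomp : ∀ X : C, ∃ (A B : C) (f : X ⟶ A) (g : A ⟶ B) (h : B ⟶ X⟦(1 : ℤ)⟧),
    A ∈ le ∧ B ∈ ge ∧ Triangle.mk f g h ∈ distTriang C

variable {C}

/-- `C^{w≤i} = C^{w≤0}[-i]`: the objects `X` with `X⟦i⟧ ∈ C^{w≤0}`. -/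
def WeightStructure.leSet (w : WeightStructure C) (i : ℤ) : Set C := {X | X⟦i⟧ ∈ w.le}

/-- `C^{w≥i} = C^{w≥0}[-i]`: the objects `X` with `X⟦i⟧ ∈ C^{w≥0}`. -/
def WeightStructure.geSet (w : WeightStructure C) (i : ℤ) : Set C := {X | X⟦i⟧ ∈ w.ge}

/-- The heart `C^{w=0} = C^{w≤0} ∩ C^{w≥0}` of a weight structure. -/
def WeightStructure.heart (w : WeightStructure C) : Set C := w.le ∩ w.ge

/-- `C^{w=i} = C^{w≥i} ∩ C^{w≤i}`. -/
def WeightStructure.eqSet (w : WeightStructure C) (i : ℤ) : Set C := w.geSet i ∩ w.leSet i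

/-- `C^{[i,j]} = C^{w≥i} ∩ C^{w≤j}`. -/
def WeightStructure.interval (w : WeightStructure C) (i j : ℤ) : Set C :=
  w.geSet i ∩ w.leSet j

/-- A weight structure is bounded if `⋃ᵢ C^{w≤i} = Obj C = ⋃ᵢ C^{w≥i}`. -/
def WeightStructure.Bounded (w : WeightStructure C) : Prop :=
  ∀ X : C, (∃ i : ℤ, X ∈ w.leSet i) ∧ (∃ j : ℤ, X ∈ w.geSet j)

universe v' u'

theorem IsRetractOf.of_iso {E : Type*} [Category E] {X Y : E} (e : X ≅ Y) : IsRetractOf X Y :=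
  ⟨e.hom, e.inv, e.hom_inv_id⟩

theorem IsRetractOf.trans {E : Type*} [Category E] {X Y Z : E} :
    IsRetractOf X Y → IsRetractOf Y Z → IsRetractOf X Z := by
  rintro ⟨i, r, h⟩ ⟨j, s, k⟩
  exact ⟨i ≫ j, s ≫ r, by rw [Category.assoc, reassoc_of% k, h]⟩

theorem IsRetractOf.map {E K : Type*} [Category E] [Category K] (G : E ⥤ K) {X Y : E} :
    IsRetractOf X Y → IsRetractOf (G.obj X) (G.obj Y) := by
  rintro ⟨i, r, h⟩
  exact ⟨G.map i, G.map r, by rw [← G.map_comp, h, G.map_id]⟩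

theorem IsRetractOf.of_map {E K : Type*} [Category E] [Category K] (G : E ⥤ K) [G.Full]
    [G.Faithful] {X Y : E} : IsRetractOf (G.obj X) (G.obj Y) → IsRetractOf X Y := by
  rintro ⟨i, r, h⟩
  exact ⟨G.preimage i, G.preimage r, G.map_injective (by simpa using h)⟩

section

variable {E : Type*} {K : Type*} [Category E] [Category K] (G : E ⥤ K)

/-- The objects of `K` that are retracts of images under `G` of objects in `S`. -/
def retractClosure (S : Set E) : Set K := {Y | ∃ X ∈ S, IsRetractOf Y (G.obj X)}

theorem mem_retractClosure_of_isRetractOf {S : Set E} {X Y : K} (h : IsRetractOf X Y) :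
    Y ∈ retractClosure G S → X ∈ retractClosure G S := by
  rintro ⟨Z, hZ, hY⟩
  exact ⟨Z, hZ, h.trans hY⟩

theorem obj_mem_retractClosure {S : Set E} {X : E} (hX : X ∈ S) :
    G.obj X ∈ retractClosure G S :=
  ⟨X, hX, .of_iso (Iso.refl _)⟩

theorem obj_mem_retractClosure_iff [G.Full] [G.Faithful] {S : Set E}
    (hS : ∀ ⦃X Y : E⦄, IsRetractOf X Y → Y ∈ S → X ∈ S) (X : E) :
    G.obj X ∈ retractClosure G S ↔ X ∈ S :=
  ⟨fun ⟨_, hZ, h⟩ => hS (h.of_map G) hZ, obj_mem_retractClosure G⟩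

theorem shift_mem_retractClosure [HasShift E ℤ] [HasShift K ℤ] [G.CommShift ℤ]
    {S S' : Set E} (n : ℤ) (hS : ∀ X ∈ S, X⟦n⟧ ∈ S') {Y : K} :
    Y ∈ retractClosure G S → Y⟦n⟧ ∈ retractClosure G S' := by
  rintro ⟨X, hX, h⟩
  exact ⟨X⟦n⟧, hS X hX, (h.map (shiftFunctor K n)).trans (.of_iso ((G.commShiftIso n).symm.app X))⟩

variable [Preadditive K]

/-- `Y` is a retract of the image of some object of `E`, with the complementary idempotent
factoring through `G.obj W`. -/
def IsSummandModulo (Y : K) (W : E) : Prop :=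
  ∃ (Z : E) (i : Y ⟶ G.obj Z) (r : G.obj Z ⟶ Y) (s : G.obj Z ⟶ G.obj W) (j : G.obj W ⟶ G.obj Z),
    i ≫ r = 𝟙 Y ∧ r ≫ i + s ≫ j = 𝟙 _

theorem IsSummandModulo.of_isRetractOf {Y : K} {X : E} (h : IsRetractOf Y (G.obj X)) :
    IsSummandModulo G Y X := by
  obtain ⟨i, r, hir⟩ := h
  exact ⟨X, i, r, 𝟙 _ - r ≫ i, 𝟙 _, hir, by simp⟩

theorem IsSummandModulo.of_iso {Y : K} {W W' : E} (e : W ≅ W') (h : IsSummandModulo G Y W) :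
    IsSummandModulo G Y W' := by
  obtain ⟨Z, i, r, s, j, hir, hsj⟩ := h
  exact ⟨Z, i, r, s ≫ G.map e.hom, G.map e.inv ≫ j, hir, by
    rw [Category.assoc, ← G.map_comp_assoc, e.hom_inv_id, G.map_id, Category.id_comp, hsj]⟩

end

/-- The middle term of a distinguished triangle is a retract of the middle term of another one
whenever the third maps are compatible with a retraction of the first terms. -/
theorem isRetractOf_obj₂ {X Y A A' B : C} {i : X ⟶ Y} {r : Y ⟶ X} (hir : i ≫ r = 𝟙 X)
    {f : X ⟶ A} {g : A ⟶ B} {h : B ⟶ X⟦(1 : ℤ)⟧} (hT : Triangle.mk f g h ∈ distTriang C)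
    {f' : Y ⟶ A'} {g' : A' ⟶ B} {h' : B ⟶ Y⟦(1 : ℤ)⟧} (hT' : Triangle.mk f' g' h' ∈ distTriang C)
    (hi : h ≫ i⟦(1 : ℤ)⟧' = h') (hr : h' ≫ r⟦(1 : ℤ)⟧' = h) : IsRetractOf A A' := by
  obtain ⟨a, ha₁, ha₂⟩ : ∃ a : A ⟶ A', f ≫ a = i ≫ f' ∧ g ≫ 𝟙 B = a ≫ g' :=
    complete_distinguished_triangle_morphism₂ _ _ hT hT' i (𝟙 B)
      (hi.trans (Category.id_comp _).symm)
  obtain ⟨b, hb₁, hb₂⟩ : ∃ b : A' ⟶ A, f' ≫ b = r ≫ f ∧ g' ≫ 𝟙 B = b ≫ g :=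
    complete_distinguished_triangle_morphism₂ _ _ hT' hT r (𝟙 B)
      (hr.trans (Category.id_comp _).symm)
  have h₁ : f ≫ a ≫ b = 𝟙 X ≫ f := by rw [reassoc_of% ha₁, hb₁, reassoc_of% hir, Category.id_comp]
  have h₂ : g ≫ 𝟙 B = (a ≫ b) ≫ g := by rw [Category.assoc, ← hb₂, ← reassoc_of% ha₂, Category.comp_id]
  have h₃ : h ≫ (𝟙 X)⟦(1 : ℤ)⟧' = 𝟙 B ≫ h := by simp
  let φ : Triangle.mk f g h ⟶ Triangle.mk f g h := ⟨𝟙 X, a ≫ b, 𝟙 B, h₁, h₂, h₃⟩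
  have : IsIso (a ≫ b) := isIso₂_of_isIso₁₃ φ hT hT (inferInstanceAs (IsIso (𝟙 X)))
    (inferInstanceAs (IsIso (𝟙 B)))
  exact ⟨a, b ≫ inv (a ≫ b), by rw [← Category.assoc, IsIso.hom_inv_id]⟩

namespace WeightStructure

variable (w : WeightStructure C)

theorem leSet_add_nat {X : C} {i : ℤ} (h : X ∈ w.leSet i) (n : ℕ) : X ∈ w.leSet (i + n) := by
  induction n with
  | zero => simpa using h
  | succ n ih =>
    refine w.le_retract (.of_iso ?_) (w.le_shift ih)
    exact (shiftFunctorAdd' C (i + n) 1 _ (by push_cast; ring)).app X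

theorem exists_nat_mem_leSet {X : C} {i : ℤ} (h : X ∈ w.leSet i) : ∃ n : ℕ, X ∈ w.leSet n := by
  refine ⟨i.toNat, ?_⟩
  have := w.leSet_add_nat h (i.toNat - i).toNat
  rwa [Int.toNat_of_nonneg (by omega), add_sub_cancel] at this

theorem mem_ge_of_orth {X : C} (hX : ∀ Y ∈ w.le, ∀ f : X ⟶ Y⟦(1 : ℤ)⟧, f = 0) : X ∈ w.ge := by
  obtain ⟨A, B, f, g, h, hA, hB, hT⟩ := w.decomp (X⟦(-1 : ℤ)⟧)
  let e : X ≅ X⟦(-1 : ℤ)⟧⟦(1 : ℤ)⟧ := (shiftNegShift X (1 : ℤ)).symm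
  obtain ⟨s, hs⟩ : ∃ s : X ⟶ B, e.hom = s ≫ h :=
    Triangle.coyoneda_exact₁ _ hT e.hom (hX A hA _)
  exact w.ge_retract ⟨s, h ≫ e.inv, by rw [← reassoc_of% hs, e.hom_inv_id]⟩ hB

theorem mem_ge_of_distTriang {T : Triangle C} (hT : T ∈ distTriang C) (h₁ : T.obj₁ ∈ w.ge)
    (h₃ : T.obj₃ ∈ w.ge) : T.obj₂ ∈ w.ge := by
  refine w.mem_ge_of_orth fun Y hY f => ?_
  obtain ⟨g, rfl⟩ := Triangle.yoneda_exact₂ T hT f (w.orth h₁ hY _)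
  rw [w.orth h₃ hY g, comp_zero]

end WeightStructure

section IdempotentCompletion

variable {D : Type u'} [Category.{v'} D] (F : C ⥤ D)

variable [Preadditive D]

theorem retractClosure_add [F.Additive] {S : Set C}
    (hS : ∀ ⦃X Y : C⦄, X ∈ S → Y ∈ S →
      ∀ b : BinaryBicone X Y, Nonempty b.IsBilimit → b.pt ∈ S) ⦃X Y : D⦄
    (hX : X ∈ retractClosure F S) (hY : Y ∈ retractClosure F S)
    (b : BinaryBicone X Y) (hb : Nonempty b.IsBilimit) : b.pt ∈ retractClosure F S := by
  obtain ⟨X', hX', i, r, hir⟩ := hX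
  obtain ⟨Y', hY', j, s, hjs⟩ := hY
  obtain ⟨hb⟩ := hb
  refine ⟨X' ⊞ Y', hS hX' hY' _ ⟨BinaryBiproduct.isBilimit X' Y'⟩,
    b.fst ≫ i ≫ F.map biprod.inl + b.snd ≫ j ≫ F.map biprod.inr,
    F.map biprod.fst ≫ r ≫ b.inl + F.map biprod.snd ≫ s ≫ b.inr, ?_⟩
  have h₁ : F.map (biprod.inl : X' ⟶ X' ⊞ Y') ≫ F.map biprod.fst = 𝟙 _ := by
    rw [← F.map_comp, biprod.inl_fst, F.map_id]
  have h₂ : F.map (biprod.inr : Y' ⟶ X' ⊞ Y') ≫ F.map biprod.snd = 𝟙 _ := by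
    rw [← F.map_comp, biprod.inr_snd, F.map_id]
  have h₃ : F.map (biprod.inl : X' ⟶ X' ⊞ Y') ≫ F.map biprod.snd = 0 := by
    rw [← F.map_comp, biprod.inl_snd, F.map_zero]
  have h₄ : F.map (biprod.inr : Y' ⟶ X' ⊞ Y') ≫ F.map biprod.fst = 0 := by
    rw [← F.map_comp, biprod.inr_fst, F.map_zero]
  simp only [Preadditive.add_comp, Preadditive.comp_add, Category.assoc, reassoc_of% h₁,
    reassoc_of% h₂, reassoc_of% h₃, reassoc_of% h₄, reassoc_of% hir, reassoc_of% hjs,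
    zero_comp, comp_zero, add_zero, zero_add]
  exact IsBilimit.binary_total hb

variable [HasShift D ℤ] [F.CommShift ℤ]

theorem retractClosure_orth [∀ n : ℤ, (shiftFunctor D n).Additive] [F.Full] [F.Additive]
    (w : WeightStructure C) ⦃X Y : D⦄ (hX : X ∈ retractClosure F w.ge)
    (hY : Y ∈ retractClosure F w.le) (f : X ⟶ Y⟦(1 : ℤ)⟧) : f = 0 := by
  obtain ⟨X', hX', i, r, hir⟩ := hX
  obtain ⟨Y', hY', j, s, hjs⟩ := hY
  obtain ⟨g, hg⟩ := F.map_surjective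
    (r ≫ f ≫ j⟦(1 : ℤ)⟧' ≫ (F.commShiftIso (1 : ℤ)).inv.app Y')
  rw [w.orth hX' hY' g, F.map_zero] at hg
  have hjs' : j⟦(1 : ℤ)⟧' ≫ s⟦(1 : ℤ)⟧' = 𝟙 _ := by
    rw [← Functor.map_comp, hjs, CategoryTheory.Functor.map_id]
  have := i ≫= hg.symm =≫ ((F.commShiftIso (1 : ℤ)).hom.app Y' ≫ s⟦(1 : ℤ)⟧')
  simpa [reassoc_of% hir, hjs'] using this

variable [HasZeroObject D] [∀ n : ℤ, (shiftFunctor D n).Additive] [Pretriangulated D]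
  [F.IsTriangulated] [F.Full]

theorem IsSummandModulo.shift {Y : D} {W : C} (h : IsSummandModulo F Y W) :
    IsSummandModulo F Y (W⟦(1 : ℤ)⟧) := by
  obtain ⟨E, i, r, s, j, hir, hsj⟩ := h
  have hsj' : s ≫ j = 𝟙 _ - r ≫ i := eq_sub_of_add_eq' hsj
  obtain ⟨m, hm⟩ := F.map_surjective (j ≫ s ≫ j)
  have hmr : F.map m ≫ r = 0 := by
    rw [hm, hsj', Preadditive.comp_sub, Preadditive.sub_comp]
    simp [hir]
  obtain ⟨G, p, d, hT⟩ := distinguished_cocone_triangle m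
  have hFT := F.map_distinguished _ hT
  have hmp : F.map m ≫ F.map p = 0 := comp_distTriang_mor_zero₁₂ _ hFT
  obtain ⟨r', hr'⟩ : ∃ r' : F.obj G ⟶ Y, r = F.map p ≫ r' := Triangle.yoneda_exact₂ _ hFT r hmr
  have hp : F.map p ≫ (𝟙 _ - r' ≫ i ≫ F.map p) = 0 := by
    have hs : s ≫ F.map m = 𝟙 _ - r ≫ i := by
      rw [hm, reassoc_of% hsj', hsj']
      simp [reassoc_of% hir]
    rw [Preadditive.comp_sub, Category.comp_id, ← reassoc_of% hr']
    have := s ≫= hmp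
    rwa [reassoc_of% hs, comp_zero, Preadditive.sub_comp, Category.id_comp,
      Category.assoc] at this
  obtain ⟨t, ht⟩ : ∃ t : (F.obj W)⟦(1 : ℤ)⟧ ⟶ F.obj G, 𝟙 _ - r' ≫ i ≫ F.map p =
      (F.map d ≫ (F.commShiftIso (1 : ℤ)).hom.app W) ≫ t := Triangle.yoneda_exact₃ _ hFT _ hp
  refine ⟨G, i ≫ F.map p, r', F.map d, (F.commShiftIso (1 : ℤ)).hom.app W ≫ t, ?_, ?_⟩
  · rw [Category.assoc, ← hr', hir]
  · rw [← Category.assoc (F.map d), ← ht, add_sub_cancel]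

theorem IsSummandModulo.shift_nat {Y : D} {X : C} (h : IsSummandModulo F Y X) (n : ℕ) :
    IsSummandModulo F Y (X⟦(n : ℤ)⟧) := by
  induction n with
  | zero => exact h.of_iso F ((shiftFunctorZero C ℤ).symm.app X)
  | succ n ih => exact (ih.shift F).of_iso F ((shiftFunctorAdd' C (n : ℤ) 1 _ (by simp)).symm.app X)

/-- Weight decompositions of an object of `C` descend to any summand (in `D`) of its image whose
complementary idempotent factors through an object of `C^{w≤0}[1]`. -/
theorem IsSummandModulo.exists_decomp (w : WeightStructure C) {Y : D} {W : C} (hW : W ∈ w.le)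
    (h : IsSummandModulo F Y (W⟦(1 : ℤ)⟧)) :
    ∃ (A B : D) (f : Y ⟶ A) (g : A ⟶ B) (h : B ⟶ Y⟦(1 : ℤ)⟧),
      A ∈ retractClosure F w.le ∧ B ∈ retractClosure F w.ge ∧
        Triangle.mk f g h ∈ distTriang D := by
  obtain ⟨E, i, r, s, j, hir, hsj⟩ := h
  obtain ⟨A, B, f, g, h, hA, hB, hT⟩ := w.decomp E
  have hFT := F.map_distinguished _ hT
  let h' : F.obj B ⟶ (F.obj E)⟦(1 : ℤ)⟧ := F.map h ≫ (F.commShiftIso (1 : ℤ)).hom.app E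
  have hs : h' ≫ s⟦(1 : ℤ)⟧' = 0 := retractClosure_orth F w (obj_mem_retractClosure F hB)
    (obj_mem_retractClosure F (w.le_shift hW)) _
  have hri : (h' ≫ r⟦(1 : ℤ)⟧') ≫ i⟦(1 : ℤ)⟧' = h' := by
    have := h' ≫= congrArg (fun k => k⟦(1 : ℤ)⟧') hsj
    simpa [Functor.map_add, reassoc_of% hs] using this
  obtain ⟨A', f', g', hT'⟩ := distinguished_cocone_triangle₂ (h' ≫ r⟦(1 : ℤ)⟧')
  exact ⟨A', F.obj B, f', g', _, ⟨A, hA, isRetractOf_obj₂ hir hT' hFT hri rfl⟩,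
    obj_mem_retractClosure F hB, hT'⟩

theorem retractClosure_le_inter_ge [F.Faithful] (w : WeightStructure C) :
    retractClosure F w.le ∩ retractClosure F w.ge = retractClosure F w.heart := by
  refine Set.Subset.antisymm ?_ fun Y ⟨X, hX, h⟩ => ⟨⟨X, hX.1, h⟩, ⟨X, hX.2, h⟩⟩
  rintro Y ⟨hY, X, hX, i, r, hir⟩
  obtain ⟨A, B, f, g, h, hA, hB, hT⟩ := w.decomp X
  have hFT := F.map_distinguished _ hT
  obtain ⟨t, ht⟩ : ∃ t : (F.obj A)⟦(1 : ℤ)⟧ ⟶ Y⟦(1 : ℤ)⟧,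
      r⟦(1 : ℤ)⟧' = (-(F.map f)⟦(1 : ℤ)⟧') ≫ t :=
    Triangle.yoneda_exact₃ _ (rot_of_distTriang _ hFT) (r⟦(1 : ℤ)⟧')
      (retractClosure_orth F w (obj_mem_retractClosure F hB) hY _)
  obtain ⟨t, rfl⟩ := (shiftFunctor D (1 : ℤ)).map_surjective t
  have hr : r = F.map f ≫ (-t) := (shiftFunctor D (1 : ℤ)).map_injective (by simpa using ht)
  exact ⟨A, ⟨hA, w.mem_ge_of_distTriang hT hX hB⟩, i ≫ F.map f, -t, by
    rw [Category.assoc, ← hr, hir]⟩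

end IdempotentCompletion

/-- Proposition 1.3.3(4): a bounded weight structure `w` on `C` extends to a bounded
weight structure on the idempotent completion of `C`, whose heart is the idempotent
completion of the heart `Hw`.  The idempotent completion is axiomatized as an
idempotent complete pretriangulated category `D` together with a fully faithful
exact (triangulated, shift-commuting) functor `F : C ⥤ D` such that every object
of `D` is a retract of an object coming from `C`. -/
theorem weightStructure_extends_to_idempotent_completion
    {D : Type u'} [Category.{v'} D] [HasZeroObject D] [Preadditive D] [HasShift D ℤ]
    [∀ n : ℤ, (shiftFunctor D n).Additive] [Pretriangulated D]
    [IsIdempotentComplete D]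
    (F : C ⥤ D) [F.CommShift ℤ] [F.IsTriangulated] [F.Full] [F.Faithful]
    (hF : ∀ Y : D, ∃ X : C, IsRetractOf Y (F.obj X))
    (w : WeightStructure C) (hw : w.Bounded) :
    ∃ w' : WeightStructure D, w'.Bounded ∧
      (∀ X : C, (X ∈ w.le ↔ F.obj X ∈ w'.le) ∧ (X ∈ w.ge ↔ F.obj X ∈ w'.ge)) ∧
      w'.heart = {Y : D | ∃ X ∈ w.heart, IsRetractOf Y (F.obj X)} := by
  let w' : WeightStructure D :=
    { le := retractClosure F w.le
      ge := retractClosure F w.ge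
      le_retract := fun _ _ h => mem_retractClosure_of_isRetractOf F h
      ge_retract := fun _ _ h => mem_retractClosure_of_isRetractOf F h
      le_add := retractClosure_add F w.le_add
      ge_add := retractClosure_add F w.ge_add
      le_shift := fun _ h => shift_mem_retractClosure F 1 (fun _ hX => w.le_shift hX) h
      ge_shift := fun _ h => shift_mem_retractClosure F (-1) (fun _ hX => w.ge_shift hX) h
      orth := retractClosure_orth F w
      decomp := fun Y => by
        obtain ⟨X, hX⟩ := hF Y
        obtain ⟨i, hi⟩ := (hw X).1
        obtain ⟨n, hn⟩ := w.exists_nat_mem_leSet hi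
        exact (((IsSummandModulo.of_isRetractOf F hX).shift_nat F n).shift F).exists_decomp F w hn }
  refine ⟨w', fun Y => ?_, fun X => ⟨(obj_mem_retractClosure_iff F w.le_retract X).symm,
    (obj_mem_retractClosure_iff F w.ge_retract X).symm⟩, retractClosure_le_inter_ge F w⟩
  obtain ⟨X, hX⟩ := hF Y
  obtain ⟨⟨i, hi⟩, ⟨j, hj⟩⟩ := hw X
  exact ⟨⟨i, shift_mem_retractClosure F i (S := {X}) (by rintro _ rfl; exact hi) ⟨X, rfl, hX⟩⟩,
    ⟨j, shift_mem_retractClosure F j (S := {X}) (by rintro _ rfl; exact hj) ⟨X, rfl, hX⟩⟩⟩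

end Paper
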